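/- Let G be the complete graph on a finite vertex set with at least 3 vertices, let M1 be a perfect matching of G, and let P be an acyclic 2-matching of G such that no edge of M1 is an edge of P. Then the edge set of P can be partitioned into three matchings Y0, Y1, Y2 such that for every j in {0, 1, 2}, the graph with edge set M1 ∪ Yj is an acyclic 2-matching of G. -/

import Mathlib

/-- A set of edges is a matching: each edge is non-diagonal (joins two distinct
vertices) and no two distinct edges share a vertex. -/
def IsMatchingSet {V : Type*} (M : Finset (Sym2 V)) : Prop :=
  (∀ e ∈ M, ¬ e.IsDiag) ∧
    ∀ e ∈ M, ∀ f ∈ M, e ≠ f → ∀ v : V, v ∈ e → v ∉ f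

/-- A set of edges is a perfect matching: a matching covering every vertex. -/
def IsPerfectMatchingSet {V : Type*} (M : Finset (Sym2 V)) : Prop :=
  IsMatchingSet M ∧ ∀ v : V, ∃ e ∈ M, v ∈ e

/-- A set of edges is a 2-matching: each edge is non-diagonal and every vertex
is incident to at most two of the edges. -/
def IsTwoMatchingSet {V : Type*} [DecidableEq V] (C : Finset (Sym2 V)) : Prop :=
  (∀ e ∈ C, ¬ e.IsDiag) ∧
    ∀ v : V, (C.filter (fun e => v ∈ e)).card ≤ 2

/-- A set of edges is an acyclic 2-matching: a 2-matching whose associated graph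
contains no cycle, i.e. it is a vertex-disjoint union of paths. -/
def IsAcyclicTwoMatchingSet {V : Type*} [DecidableEq V] (C : Finset (Sym2 V)) : Prop :=
  IsTwoMatchingSet C ∧ (SimpleGraph.fromEdgeSet (↑C : Set (Sym2 V))).IsAcyclic

namespace SimpleGraph

variable {V : Type*} {G : SimpleGraph V}

/-- A nonempty acyclic graph on finitely many vertices has a leaf. -/
theorem IsAcyclic.exists_leaf [Finite V] (hG : G.IsAcyclic) {a b : V} (hab : G.Adj a b) :
    ∃ u v, G.Adj u v ∧ ∀ x, G.Adj u x → x = v := by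
  have : Nonempty V := ⟨a⟩
  obtain ⟨u, w, p, hp, hmax⟩ := Walk.exists_isPath_forall_isPath_length_le_length G
  have hpos : 0 < p.length := by
    have := hmax a b (.cons hab .nil) (by simp [hab.ne])
    simp at this
    omega
  have hnil : ¬ p.Nil := by
    rw [← Walk.length_eq_zero_iff]
    omega
  refine ⟨u, p.snd, p.adj_snd hnil, fun x hx ↦ ?_⟩
  refine hG.eq_snd_of_adj_start hp hx ?_
  by_contra hxp
  have := hmax _ _ (.cons hx.symm p) (hp.cons hxp)
  simp at this

theorem Reachable.mem_of_forall_adj {s : Set V} (hs : ∀ x ∈ s, ∀ y, G.Adj x y → y ∈ s) {a b : V}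
    (ha : a ∈ s) (h : G.Reachable a b) : b ∈ s := by
  obtain ⟨p⟩ := h
  induction p with
  | nil => exact ha
  | cons hadj _ ih => exact ih (hs _ ha _ hadj)

theorem Walk.IsPath.eq_of_ends_of_avoid
    (hdeg : ∀ v a b c, G.Adj v a → G.Adj v b → G.Adj v c → a = b ∨ a = c ∨ b = c)
    {t v w₁ w₂ : V} (htv : G.Adj v t) {p : G.Walk v w₁} {q : G.Walk v w₂}
    (hp : p.IsPath) (hq : q.IsPath) (htp : t ∉ p.support) (htq : t ∉ q.support)
    (h₁ : ∀ a b, G.Adj w₁ a → G.Adj w₁ b → a = b)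
    (h₂ : ∀ a b, G.Adj w₂ a → G.Adj w₂ b → a = b) : w₁ = w₂ := by
  induction p generalizing t with
  | nil =>
    cases q with
    | nil => rfl
    | cons h q =>
      obtain rfl := h₁ _ _ htv h
      simp at htq
  | @cons v x w₁ h p ih =>
    cases q with
    | nil =>
      obtain rfl := h₂ _ _ htv h
      simp at htp
    | @cons _ y _ h' q =>
      rw [cons_isPath_iff] at hp hq
      have hx : t ≠ x := by rintro rfl; simp at htp
      have hy : t ≠ y := by rintro rfl; simp at htq
      obtain rfl : x = y := by have := hdeg _ _ _ _ htv h h'; tauto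
      exact ih h.symm hp.1 hq.1 hp.2 hq.2 h₁

/-- In a graph of maximum degree two, a component has at most two vertices of degree at most
one. -/
theorem eq_of_reachable_of_reachable
    (hdeg : ∀ v a b c, G.Adj v a → G.Adj v b → G.Adj v c → a = b ∨ a = c ∨ b = c)
    {v w₁ w₂ : V} (hw₁ : G.Reachable v w₁) (hw₂ : G.Reachable v w₂) (hv₁ : v ≠ w₁) (hv₂ : v ≠ w₂)
    (h : ∀ a b, G.Adj v a → G.Adj v b → a = b)
    (h₁ : ∀ a b, G.Adj w₁ a → G.Adj w₁ b → a = b)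
    (h₂ : ∀ a b, G.Adj w₂ a → G.Adj w₂ b → a = b) : w₁ = w₂ := by
  obtain ⟨p, hp⟩ := hw₁.exists_isPath
  obtain ⟨q, hq⟩ := hw₂.exists_isPath
  cases p with
  | nil => exact absurd rfl hv₁
  | cons hx p =>
    cases q with
    | nil => exact absurd rfl hv₂
    | cons hy q =>
      obtain rfl := h _ _ hx hy
      rw [Walk.cons_isPath_iff] at hp hq
      exact hp.1.eq_of_ends_of_avoid hdeg hx.symm hq.1 hp.2 hq.2 h₁ h₂

/-- If `u` has no neighbour besides `u'` and vice versa, an edge from `u` elsewhere closes no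
cycle. -/
theorem IsAcyclic.sup_edge_of_pair (hG : G.IsAcyclic) {u u' v : V}
    (hu : ∀ x, G.Adj u x → x = u') (hu' : ∀ x, G.Adj u' x → x = u) (hvu : v ≠ u) (hvu' : v ≠ u') :
    (G ⊔ edge u v).IsAcyclic := by
  refine hG.sup_edge_of_not_reachable fun h ↦ ?_
  have := h.mem_of_forall_adj (s := {u, u'}) (by grind) (by simp)
  grind

theorem IsAcyclic.sup_edge_sup_edge_of_pair (hG : G.IsAcyclic) {u u' v w : V}
    (hu : ∀ x, G.Adj u x → x = u') (hu' : ∀ x, G.Adj u' x → x = u)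
    (hvu : v ≠ u) (hvu' : v ≠ u') (hwu : w ≠ u) (hwu' : w ≠ u') (h : ¬ G.Reachable w v) :
    (G ⊔ edge u' w ⊔ edge u v).IsAcyclic := by
  refine (hG.sup_edge_of_pair hu' hu hwu' hwu).sup_edge_of_not_reachable fun hr ↦ ?_
  have := hr.mem_of_forall_adj (s := {x | x = u ∨ x = u' ∨ G.Reachable w x}) ?_ (by simp)
  · grind
  · rintro x hx y hxy
    rw [sup_adj, edge_adj] at hxy
    obtain hxy | ⟨⟨rfl, rfl⟩ | ⟨rfl, rfl⟩, -⟩ := hxy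
    · obtain rfl | rfl | hx := hx
      · exact .inr (.inl (hu _ hxy))
      · exact .inl (hu' _ hxy)
      · exact .inr (.inr (hx.trans hxy.reachable))
    · exact .inr (.inr .rfl)
    · simp

end SimpleGraph

theorem exists_fin_three_ne (a b : Fin 3) : ∃ i j : Fin 3, i ≠ a ∧ j ≠ b ∧ i ≠ j := by
  decide +revert

theorem exists_fin_three_distinct_or_eq (a b c : Fin 3) :
    (∃ i j k : Fin 3, i ≠ a ∧ j ≠ b ∧ k ≠ c ∧ i ≠ j ∧ i ≠ k ∧ j ≠ k) ∨ a = b ∧ a = c := by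
  decide +revert

/-- List colouring, from three colours, of an edge towards `v` and of at most two edges towards
the vertices in `N`, where each endpoint forbids at most one colour. The edge towards `v` may
repeat a colour only if this does not close a cycle, as recorded by `R`. -/
theorem exists_colors_of_forbidden {V : Type*} [DecidableEq V] (v : V) (N : V → Prop)
    (ok : V → Fin 3 → Prop) (R : Fin 3 → V → V → Prop)
    (hN : ∀ a b c, N a → N b → N c → a = b ∨ a = c ∨ b = c)
    (hok : ∀ x, N x ∨ x = v → ∃ g, ∀ j ≠ g, ok x j)
    (hv : N v → ∀ j, ok v j)
    (hR : ∀ j w₁ w₂, v ≠ w₁ → v ≠ w₂ → ok v j → ok w₁ j → ok w₂ j → R j w₁ v → R j w₂ v → w₁ = w₂) :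
    ∃ (i : Fin 3) (k : V → Fin 3), ok v i ∧ (∀ w, N w → ok w (k w)) ∧
      (∀ w w', N w → N w' → k w = k w' → w = w') ∧ (N v → k v ≠ i) ∧
      ∀ w, N w → k w = i → ¬ R i w v := by
  obtain ⟨g, hg⟩ := hok v (.inr rfl)
  by_cases h2 : ∃ w₁ w₂, N w₁ ∧ N w₂ ∧ w₁ ≠ w₂
  · obtain ⟨w₁, w₂, hw₁, hw₂, hne⟩ := h2
    have hNw : ∀ w, N w → w = w₁ ∨ w = w₂ := fun w hw ↦ by
      have := hN _ _ _ hw hw₁ hw₂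
      tauto
    obtain ⟨g₁, hg₁⟩ := hok w₁ (.inl hw₁)
    obtain ⟨g₂, hg₂⟩ := hok w₂ (.inl hw₂)
    have key : ∀ i j₁ j₂, ok v i → ok w₁ j₁ → ok w₂ j₂ → j₁ ≠ j₂ → (N v → i ≠ j₁ ∧ i ≠ j₂) →
        (j₁ = i → ¬ R i w₁ v) → (j₂ = i → ¬ R i w₂ v) →
        ∃ (i : Fin 3) (k : V → Fin 3), ok v i ∧ (∀ w, N w → ok w (k w)) ∧
      (∀ w w', N w → N w' → k w = k w' → w = w') ∧ (N v → k v ≠ i) ∧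
      ∀ w, N w → k w = i → ¬ R i w v := by
      intro i j₁ j₂ hi hj₁ hj₂ hj hiv hR₁ hR₂
      refine ⟨i, fun w ↦ if w = w₁ then j₁ else j₂, hi, ?_, ?_, ?_, ?_⟩ <;> grind
    by_cases hNv : N v
    · obtain ⟨j₁, j₂, h₁, h₂, h₁₂⟩ := exists_fin_three_ne g₁ g₂
      obtain ⟨i, h, h'⟩ : ∃ i : Fin 3, i ≠ j₁ ∧ i ≠ j₂ := by
        clear * -; decide +revert
      exact key i j₁ j₂ (hv hNv i) (hg₁ _ h₁) (hg₂ _ h₂) h₁₂ (by tauto) (by tauto) (by tauto)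
    · obtain ⟨i, j₁, j₂, hi, h₁, h₂, hi₁, hi₂, h₁₂⟩ | ⟨rfl, rfl⟩ :=
        exists_fin_three_distinct_or_eq g g₁ g₂
      · exact key i j₁ j₂ (hg _ hi) (hg₁ _ h₁) (hg₂ _ h₂) h₁₂ (by tauto) (by tauto) (by tauto)
      · obtain ⟨i, j, hi, hj, hij⟩ := exists_fin_three_ne g g
        have hR' : ¬ R i w₁ v ∨ ¬ R i w₂ v := by
          by_contra! h
          exact hne (hR i w₁ w₂ (by grind) (by grind) (hg _ hi) (hg₁ _ hi) (hg₂ _ hi) h.1 h.2)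
        obtain h | h := hR'
        · exact key i i j (hg _ hi) (hg₁ _ hi) (hg₂ _ hj) hij (by tauto) (by tauto) (by tauto)
        · exact key i j i (hg _ hi) (hg₁ _ hj) (hg₂ _ hi) hij.symm (by tauto) (by tauto) (by tauto)
  · push Not at h2
    by_cases h1 : ∃ w, N w
    · obtain ⟨w, hw⟩ := h1
      obtain ⟨g₁, hg₁⟩ := hok w (.inl hw)
      obtain ⟨i, j, hi, hj, hij⟩ := exists_fin_three_ne g g₁
      refine ⟨i, fun _ ↦ j, hg _ hi, ?_, ?_, ?_, ?_⟩ <;> grind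
    · refine ⟨g + 1, fun _ ↦ 0, hg _ (by simp), ?_, ?_, ?_, ?_⟩ <;> grind

theorem SimpleGraph.isAcyclic_of_subsingleton_neighbors {V : Type*} {G : SimpleGraph V}
    (h : ∀ v a b, G.Adj v a → G.Adj v b → a = b) : G.IsAcyclic := by
  intro v p hp
  exact hp.snd_ne_penultimate (h _ _ _ (p.adj_snd hp.not_nil) (p.adj_penultimate hp.not_nil).symm)

open SimpleGraph in
/-- Adding back to a coloured edge set the edges meeting a matching edge `s(u, u')`, one end `u` of
which is a leaf. -/
theorem exists_coloring_of_leaf {V : Type*} [DecidableEq V] (M P : Finset (Sym2 V))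
    (hM : ∀ v a b, s(v, a) ∈ M → s(v, b) ∈ M → a = b)
    (hMloop : ∀ v, s(v, v) ∉ M)
    (hloop : ∀ v, s(v, v) ∉ P)
    (hdeg : ∀ v a b c, s(v, a) ∈ P → s(v, b) ∈ P → s(v, c) ∈ P → a = b ∨ a = c ∨ b = c)
    (hdisj : ∀ e ∈ M, e ∉ P) {u u' v : V} (huu' : s(u, u') ∈ M) (huv : s(u, v) ∈ P)
    (hleaf : ∀ x, s(u, x) ∈ P → x = v) {P' : Finset (Sym2 V)}
    (hP' : ∀ e, e ∈ P' ↔ e ∈ P ∧ u ∉ e ∧ u' ∉ e) {c' : Sym2 V → Fin 3}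
    (hc' : ∀ v a b, s(v, a) ∈ P' → s(v, b) ∈ P' → c' s(v, a) = c' s(v, b) → a = b)
    (hac' : ∀ j, (fromEdgeSet {e | e ∈ M ∨ e ∈ P' ∧ c' e = j}).IsAcyclic) :
    ∃ c : Sym2 V → Fin 3,
      (∀ v a b, s(v, a) ∈ P → s(v, b) ∈ P → c s(v, a) = c s(v, b) → a = b) ∧
      ∀ j, (fromEdgeSet {e | e ∈ M ∨ e ∈ P ∧ c e = j}).IsAcyclic := by
  have hvu : v ≠ u := by rintro rfl; exact hloop _ huv
  have hvu' : v ≠ u' := by rintro rfl; exact hdisj _ huu' huv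
  have hne : u ≠ u' := by rintro rfl; exact hMloop _ huu'
  have huP : s(u, u') ∉ P := hdisj _ huu'
  have hP'' : ∀ a b, s(a, b) ∈ P' ↔ s(a, b) ∈ P ∧ u ≠ a ∧ u ≠ b ∧ u' ≠ a ∧ u' ≠ b := fun a b ↦ by
    rw [hP']; simp; tauto
  have hMs : ∀ a b, s(a, b) ∈ M → s(b, a) ∈ M := fun a b h ↦ by rwa [Sym2.eq_swap]
  have hPs : ∀ a b, s(a, b) ∈ P → s(b, a) ∈ P := fun a b h ↦ by rwa [Sym2.eq_swap]
  have hPc : ∀ a b j, s(a, b) ∈ P' ∧ c' s(a, b) = j → s(b, a) ∈ P' ∧ c' s(b, a) = j :=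
    fun a b j h ↦ by rwa [Sym2.eq_swap]
  obtain ⟨i, k, hi, hk, hkinj, hkv, hreach⟩ := exists_colors_of_forbidden v
    (fun w ↦ s(u', w) ∈ P) (fun w j ↦ ∀ x, s(w, x) ∈ P' → c' s(w, x) ≠ j)
    (fun j a b ↦ (fromEdgeSet {e | e ∈ M ∨ e ∈ P' ∧ c' e = j}).Reachable a b)
    (hdeg u')
    (by
      intro w hw
      obtain ⟨t, ht, htw⟩ : ∃ t, (t = u ∨ t = u') ∧ s(w, t) ∈ P := by
        obtain hw | rfl := hw
        · exact ⟨u', .inr rfl, hPs _ _ hw⟩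
        · exact ⟨u, .inl rfl, hPs _ _ huv⟩
      by_cases h : ∃ x, s(w, x) ∈ P'
      · obtain ⟨x, hx⟩ := h
        refine ⟨c' s(w, x), fun j hj y hy hyj ↦ hj ?_⟩
        rw [hP''] at hx hy
        have := hdeg w x y t hx.1 hy.1 htw
        grind
      · push Not at h
        exact ⟨0, fun j _ x hx ↦ absurd hx (h x)⟩)
    (by
      intro hv j x hx
      rw [hP''] at hx
      have := hdeg v x u u' hx.1 (hPs _ _ huv) (hPs _ _ hv)
      tauto)
    (by
      intro j w₁ w₂ h₁ h₂ hv hw₁ hw₂ hr₁ hr₂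
      refine eq_of_reachable_of_reachable ?_ hr₁.symm hr₂.symm h₁ h₂ ?_ ?_ ?_ <;>
      · simp only [fromEdgeSet_adj, Set.mem_ofPred_eq]
        grind)
  obtain ⟨c, hcu, hcu', hc⟩ : ∃ c : Sym2 V → Fin 3, (∀ x, c s(u, x) = i) ∧
      (∀ x, x ≠ u → c s(u', x) = k x) ∧ ∀ e, u ∉ e → u' ∉ e → c e = c' e := by
    refine ⟨fun e ↦ if u ∈ e then i else if h : u' ∈ e then k (Sym2.Mem.other h) else c' e,
      by simp, fun x hx ↦ ?_, by grind⟩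
    have h : u' ∈ s(u', x) := by simp
    have hux : u ∉ s(u', x) := by simp [hne, hx.symm]
    simp only [if_neg hux, dif_pos h, Sym2.congr_right.1 (Sym2.other_spec h)]
  have hcu₂ : ∀ x, c s(x, u) = i := fun x ↦ by rw [Sym2.eq_swap, hcu]
  have hcu₂' : ∀ x, x ≠ u → c s(x, u') = k x := fun x hx ↦ by rw [Sym2.eq_swap, hcu' x hx]
  have hc₂ : ∀ a b, u ≠ a → u ≠ b → u' ≠ a → u' ≠ b → c s(a, b) = c' s(a, b) :=
    fun a b _ _ _ _ ↦ hc _ (by simp [*]) (by simp [*])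
  refine ⟨c, fun x a b ha hb hab ↦ ?_, fun j ↦ ?_⟩
  · obtain rfl | hxu := eq_or_ne u x
    · rw [hleaf a ha, hleaf b hb]
    have hP : ∀ y, s(x, y) ∈ P → u ≠ y → u' ≠ x → u' ≠ y → s(x, y) ∈ P' ∧ c s(x, y) = c' s(x, y) :=
      fun y h h₁ h₂ h₃ ↦ ⟨(hP'' _ _).2 ⟨h, hxu, h₁, h₂, h₃⟩, hc₂ _ _ hxu h₁ h₂ h₃⟩
    obtain rfl | hxu' := eq_or_ne u' x
    · have hau : a ≠ u := by rintro rfl; exact huP (hPs _ _ ha)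
      have hbu : b ≠ u := by rintro rfl; exact huP (hPs _ _ hb)
      rw [hcu' a hau, hcu' b hbu] at hab
      exact hkinj a b ha hb hab
    have hcross : ∀ y, s(x, u) ∈ P → s(x, y) ∈ P → c s(x, u) = c s(x, y) → u = y := by
      intro y h h' heq
      obtain rfl := hleaf x (hPs _ _ h)
      by_contra hy
      rw [hcu₂] at heq
      obtain rfl | hy' := eq_or_ne u' y
      · rw [hcu₂' x hvu] at heq
        exact hkv (hPs _ _ h') heq.symm
      · obtain ⟨h₁, h₂⟩ := hP y h' hy hxu' hy'
        exact hi y h₁ (h₂ ▸ heq.symm)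
    have hcross' : ∀ y, u ≠ y → s(x, u') ∈ P → s(x, y) ∈ P → c s(x, u') = c s(x, y) → u' = y := by
      intro y hy h h' heq
      by_contra hy'
      rw [hcu₂' x hxu.symm] at heq
      obtain ⟨h₁, h₂⟩ := hP y h' hy hxu' hy'
      exact hk x (hPs _ _ h) y h₁ (h₂ ▸ heq.symm)
    obtain rfl | hau := eq_or_ne u a
    · exact hcross b ha hb hab
    obtain rfl | hbu := eq_or_ne u b
    · exact (hcross a hb ha hab.symm).symm
    obtain rfl | hau' := eq_or_ne u' a
    · exact hcross' b hbu ha hb hab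
    obtain rfl | hbu' := eq_or_ne u' b
    · exact (hcross' a hau hb ha hab.symm).symm
    obtain ⟨h₁, h₂⟩ := hP a ha hau hxu' hau'
    obtain ⟨h₃, h₄⟩ := hP b hb hbu hxu' hbu'
    exact hc' x a b h₁ h₃ (h₂ ▸ h₄ ▸ hab)
  · set G := fromEdgeSet {e | e ∈ M ∨ e ∈ P' ∧ c' e = j}
    have hGu : ∀ x, G.Adj u x → x = u' := by
      rintro x ⟨h | h, -⟩
      · exact hM _ _ _ h huu'
      · exact absurd rfl ((hP'' _ _).1 h.1).2.1
    have hGu' : ∀ x, G.Adj u' x → x = u := by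
      rintro x ⟨h | h, -⟩
      · exact hM _ _ _ h (hMs _ _ huu')
      · exact absurd rfl ((hP'' _ _).1 h.1).2.2.2.1
    have hadj : ∀ a b, (fromEdgeSet {e | e ∈ M ∨ e ∈ P ∧ c e = j}).Adj a b → G.Adj a b ∨
        (i = j ∧ (edge u v).Adj a b) ∨ ∃ w, s(u', w) ∈ P ∧ k w = j ∧ (edge u' w).Adj a b := by
      rintro a b ⟨h | ⟨h, hj⟩, hab⟩
      · exact .inl ⟨.inl h, hab⟩
      · simp only [edge_adj]
        have hua : a = u → b = v := by rintro rfl; exact hleaf _ h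
        have hub : b = u → a = v := by rintro rfl; exact hleaf _ (hPs _ _ h)
        obtain rfl | hau := eq_or_ne u a
        · grind
        obtain rfl | hbu := eq_or_ne u b
        · grind
        obtain rfl | hau' := eq_or_ne u' a
        · exact .inr (.inr ⟨b, h, by grind, by grind⟩)
        obtain rfl | hbu' := eq_or_ne u' b
        · exact .inr (.inr ⟨a, hPs _ _ h, by grind, by grind⟩)
        · exact .inl ⟨.inr ⟨(hP'' _ _).2 ⟨h, hau, hbu, hau', hbu'⟩,
            hc₂ _ _ hau hbu hau' hbu' ▸ hj⟩, hab⟩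
    by_cases hw : ∃ w, s(u', w) ∈ P ∧ k w = j
    · obtain ⟨w, hw, hkw⟩ := hw
      have hwu : w ≠ u := by rintro rfl; exact huP (hPs _ _ hw)
      have hwu' : w ≠ u' := by rintro rfl; exact hloop _ hw
      have huniq : ∀ x, s(u', x) ∈ P → k x = j → x = w :=
        fun x hx hxj ↦ hkinj _ _ hx hw (hxj.trans hkw.symm)
      by_cases hij : i = j
      · subst hij
        refine ((hac' i).sup_edge_sup_edge_of_pair hGu hGu' hvu hvu' hwu hwu'
          (hreach w hw hkw)).anti fun a b hab ↦ ?_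
        simp only [sup_adj]
        obtain h | h | ⟨x, hx, hxj, h⟩ := hadj a b hab
        · exact .inl (.inl h)
        · exact .inr h.2
        · exact .inl (.inr (huniq x hx hxj ▸ h))
      · refine ((hac' j).sup_edge_of_pair hGu' hGu hwu' hwu).anti fun a b hab ↦ ?_
        obtain h | h | ⟨x, hx, hxj, h⟩ := hadj a b hab
        · exact .inl h
        · exact absurd h.1 hij
        · exact .inr (huniq x hx hxj ▸ h)
    · refine ((hac' j).sup_edge_of_pair hGu hGu' hvu hvu').anti fun a b hab ↦ ?_
      obtain h | h | ⟨x, hx, hxj, h⟩ := hadj a b hab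
      · exact .inl h
      · exact .inr h.2
      · exact absurd ⟨x, hx, hxj⟩ hw

open SimpleGraph in
/-- The edges of an acyclic 2-matching disjoint from a perfect matching `M` can be properly
coloured with three colours so that each colour class together with `M` is acyclic. -/
theorem exists_coloring_of_perfect_matching {V : Type*} [Finite V] [DecidableEq V]
    (M P : Finset (Sym2 V))
    (hM : ∀ v a b, s(v, a) ∈ M → s(v, b) ∈ M → a = b) (hMloop : ∀ v, s(v, v) ∉ M)
    (hMcover : ∀ v, ∃ w, s(v, w) ∈ M) (hloop : ∀ v, s(v, v) ∉ P)
    (hdeg : ∀ v a b c, s(v, a) ∈ P → s(v, b) ∈ P → s(v, c) ∈ P → a = b ∨ a = c ∨ b = c)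
    (hac : (fromEdgeSet (P : Set (Sym2 V))).IsAcyclic) (hdisj : ∀ e ∈ M, e ∉ P) :
    ∃ c : Sym2 V → Fin 3,
      (∀ v a b, s(v, a) ∈ P → s(v, b) ∈ P → c s(v, a) = c s(v, b) → a = b) ∧
      ∀ j, (fromEdgeSet {e | e ∈ M ∨ e ∈ P ∧ c e = j}).IsAcyclic := by
  induction P using Finset.strongInduction with
  | H P ih =>
  obtain rfl | ⟨e, he⟩ := P.eq_empty_or_nonempty
  · refine ⟨fun _ ↦ 0, by simp, fun j ↦ isAcyclic_of_subsingleton_neighbors fun v a b ha hb ↦ ?_⟩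
    exact hM v a b (by simpa using ha.1) (by simpa using hb.1)
  · induction e with | _ a b =>
    have hab : (fromEdgeSet (P : Set (Sym2 V))).Adj a b :=
      ⟨he, by rintro rfl; exact hloop _ he⟩
    obtain ⟨u, v, huv, hleaf⟩ := hac.exists_leaf hab
    obtain ⟨u', huu'⟩ := hMcover u
    have hsub : P.filter (fun e ↦ u ∉ e ∧ u' ∉ e) ⊆ P := Finset.filter_subset _ _
    obtain ⟨c', hc', hac'⟩ := ih (P.filter fun e ↦ u ∉ e ∧ u' ∉ e)
      (Finset.filter_ssubset.2 ⟨s(u, v), huv.1, by simp⟩) (fun v h ↦ hloop v (hsub h))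
      (fun v a b c ha hb hc ↦ hdeg v a b c (hsub ha) (hsub hb) (hsub hc))
      (hac.anti (fromEdgeSet_mono (by exact_mod_cast hsub))) (fun e he h ↦ hdisj e he (hsub h))
    refine exists_coloring_of_leaf M P hM hMloop hloop hdeg hdisj huu' huv.1
      (fun x hx ↦ hleaf x ⟨hx, ?_⟩) (fun e ↦ Finset.mem_filter) hc' hac'
    rintro rfl
    exact hloop _ hx

theorem IsMatchingSet.eq_of_mem {V : Type*} {M : Finset (Sym2 V)} (hM : IsMatchingSet M)
    {v a b : V} (ha : s(v, a) ∈ M) (hb : s(v, b) ∈ M) : a = b := by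
  by_contra hab
  exact hM.2 _ ha _ hb (by rwa [Ne, Sym2.congr_right]) v (by simp) (by simp)

theorem IsMatchingSet.card_filter_le_one {V : Type*} [DecidableEq V] {M : Finset (Sym2 V)}
    (hM : IsMatchingSet M) (v : V) : (M.filter (fun e => v ∈ e)).card ≤ 1 := by
  rw [Finset.card_le_one]
  intro e he f hf
  rw [Finset.mem_filter] at he hf
  by_contra hef
  exact hM.2 e he.1 f hf.1 hef v he.2 hf.2

theorem IsMatchingSet.union {V : Type*} [DecidableEq V] {M N : Finset (Sym2 V)}
    (hM : IsMatchingSet M) (hN : IsMatchingSet N) : IsTwoMatchingSet (M ∪ N) := by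
  refine ⟨fun e he ↦ (Finset.mem_union.1 he).elim (hM.1 e) (hN.1 e), fun v ↦ ?_⟩
  rw [Finset.filter_union]
  exact (Finset.card_union_le _ _).trans
    (add_le_add (hM.card_filter_le_one v) (hN.card_filter_le_one v))

theorem IsTwoMatchingSet.eq_or_eq_or_eq {V : Type*} [DecidableEq V] {P : Finset (Sym2 V)}
    (hP : IsTwoMatchingSet P) {v a b c : V} (ha : s(v, a) ∈ P) (hb : s(v, b) ∈ P)
    (hc : s(v, c) ∈ P) : a = b ∨ a = c ∨ b = c := by
  by_contra! h
  refine (hP.2 v).not_gt (Finset.two_lt_card.2 ⟨s(v, a), ?_, s(v, b), ?_, s(v, c), ?_, ?_⟩) <;>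
    simp only [Finset.mem_filter, Sym2.mem_iff, true_or, ne_eq, Sym2.congr_right, *,
      not_false_eq_true, and_self]

/-- In the complete graph on a finite vertex set with at least 3 vertices,
if `M1` is a perfect matching and `P` is an acyclic 2-matching sharing no edge with `M1`,
then the edge set of `P` can be partitioned into three matchings `Y 0, Y 1, Y 2` such that
each `M1 ∪ Y j` is an acyclic 2-matching. (Edges of matchings and 2-matchings are
non-diagonal, hence automatically edges of the complete graph.) -/
theorem stmt4 {V : Type*} [Fintype V] [DecidableEq V]
    (hV : 3 ≤ Fintype.card V)
    (M1 : Finset (Sym2 V)) (hM1 : IsPerfectMatchingSet M1)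
    (P : Finset (Sym2 V)) (hP : IsAcyclicTwoMatchingSet P)
    (hdisj : Disjoint M1 P) :
    ∃ Y : Fin 3 → Finset (Sym2 V),
      (∀ i j, i ≠ j → Disjoint (Y i) (Y j)) ∧
      (Y 0 ∪ Y 1 ∪ Y 2 = P) ∧
      ∀ j : Fin 3, IsMatchingSet (Y j) ∧ IsAcyclicTwoMatchingSet (M1 ∪ Y j) := by
  have hPloop : ∀ v, s(v, v) ∉ P := fun v h ↦ hP.1.1 _ h (by simp)
  have hMcover : ∀ v, ∃ w, s(v, w) ∈ M1 := fun v ↦ by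
    obtain ⟨e, he, hv⟩ := hM1.2 v
    obtain ⟨w, rfl⟩ := hv
    exact ⟨w, he⟩
  obtain ⟨c, hc, hac⟩ := exists_coloring_of_perfect_matching M1 P
    (fun _ _ _ ↦ hM1.1.eq_of_mem) (fun v h ↦ hM1.1.1 _ h (by simp)) hMcover hPloop
    (fun _ _ _ _ ↦ hP.1.eq_or_eq_or_eq) hP.2 (fun _ ↦ (Finset.disjoint_left.1 hdisj ·))
  refine ⟨fun j ↦ P.filter (fun e ↦ c e = j), fun i j hij ↦ ?_, ?_, fun j ↦ ?_⟩
  · rw [Finset.disjoint_filter]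
    rintro e - rfl
    exact hij
  · ext e
    simp only [Finset.mem_union, Finset.mem_filter]
    have : c e = 0 ∨ c e = 1 ∨ c e = 2 := by
      generalize c e = x
      decide +revert
    tauto
  · have hY : IsMatchingSet (P.filter (fun e ↦ c e = j)) := by
      refine ⟨fun e he ↦ hP.1.1 e (Finset.mem_filter.1 he).1, ?_⟩
      rintro e he f hf hef v ⟨a, rfl⟩ ⟨b, rfl⟩
      rw [Finset.mem_filter] at he hf
      exact hef (by rw [hc v a b he.1 hf.1 (he.2.trans hf.2.symm)])
    refine ⟨hY, hM1.1.union hY, (hac j).anti (SimpleGraph.fromEdgeSet_mono fun e he ↦ ?_)⟩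
    simpa using he
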